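/- Let A be a reverse deterministic generalized Büchi automaton, M a finite Markov chain, G = A × M their product graph, and let C be a complete SCC of G with K = H(C). Then for every finite path ρ lying in C there exists a finite path σ_K in K such that every finite path σ in C with proj(σ) = σ_K contains ρ as a contiguous fragment (ρ ⊴ σ). -/

import Mathlib

open scoped ENNReal

/-- LTL formulas over atomic propositions `AP`. -/
inductive LTL (AP : Type) : Type
  | atom : AP → LTL AP
  | neg : LTL AP → LTL AP
  | conj : LTL AP → LTL AP → LTL AP
  | next : LTL AP → LTL AP
  | untl : LTL AP → LTL AP → LTL AP

namespace LTL

/-- Semantics of LTL over infinite words `w : ℕ → Set AP`. -/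
def Sat {AP : Type} : (ℕ → Set AP) → LTL AP → Prop
  | w, atom p => p ∈ w 0
  | w, neg φ => ¬ Sat w φ
  | w, conj φ ψ => Sat w φ ∧ Sat w ψ
  | w, next φ => Sat (fun i => w (i + 1)) φ
  | w, untl φ ψ =>
      ∃ j : ℕ, Sat (fun i => w (i + j)) ψ ∧ ∀ i < j, Sat (fun k => w (k + i)) φ

/-- `Subf ψ φ` : `ψ` is a subformula of `φ`. -/
inductive Subf {AP : Type} : LTL AP → LTL AP → Prop
  | refl (φ : LTL AP) : Subf φ φ
  | negI {ψ φ : LTL AP} : Subf ψ φ → Subf ψ (neg φ)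
  | conjL {ψ φ₁ φ₂ : LTL AP} : Subf ψ φ₁ → Subf ψ (conj φ₁ φ₂)
  | conjR {ψ φ₁ φ₂ : LTL AP} : Subf ψ φ₂ → Subf ψ (conj φ₁ φ₂)
  | nextI {ψ φ : LTL AP} : Subf ψ φ → Subf ψ (next φ)
  | untlL {ψ φ₁ φ₂ : LTL AP} : Subf ψ φ₁ → Subf ψ (untl φ₁ φ₂)
  | untlR {ψ φ₁ φ₂ : LTL AP} : Subf ψ φ₂ → Subf ψ (untl φ₁ φ₂)

/-- Elementary formulas `el φ`. -/
def el {AP : Type} : LTL AP → Set (LTL AP)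
  | atom _ => ∅
  | neg ψ => el ψ
  | conj φ ψ => el φ ∪ el ψ
  | next ψ => insert (next ψ) (el ψ)
  | untl φ ψ => insert (next (untl φ ψ)) (el φ ∪ el ψ)

/-- The satisfaction relation `(V, a) ⊩ ψ`. -/
def sd {AP : Type} (V : Set (LTL AP)) (a : Set AP) : LTL AP → Prop
  | atom p => p ∈ a
  | neg ψ => ¬ sd V a ψ
  | conj φ ψ => sd V a φ ∧ sd V a ψ
  | next ψ => next ψ ∈ V
  | untl φ ψ => sd V a ψ ∨ (sd V a φ ∧ next (untl φ ψ) ∈ V)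

end LTL

/-- A generalized Büchi automaton with alphabet `Al` and state space `Q`. -/
structure GBA (Al : Type) (Q : Type) where
  T : Q → Al → Set Q
  init : Set Q
  acc : Set (Set (Q × Al × Q))

namespace GBA

variable {Al Q : Type}

/-- A run of the automaton over the word `w`. -/
def IsRun (Au : GBA Al Q) (w : ℕ → Al) (ρ : ℕ → Q) : Prop :=
  ρ 0 ∈ Au.init ∧ ∀ i, ρ (i + 1) ∈ Au.T (ρ i) (w i)

/-- An accepting run: for each accepting set, some transition in it occurs at
infinitely many positions. -/
def IsAcceptingRun (Au : GBA Al Q) (w : ℕ → Al) (ρ : ℕ → Q) : Prop :=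
  Au.IsRun w ρ ∧ ∀ F ∈ Au.acc, {i : ℕ | (ρ i, w i, ρ (i + 1)) ∈ F}.Infinite

/-- The language of the automaton. -/
def Lang (Au : GBA Al Q) : Set (ℕ → Al) :=
  {w | ∃ ρ : ℕ → Q, Au.IsAcceptingRun w ρ}

/-- The automaton `Au` with single initial state `q`. -/
def from1 (Au : GBA Al Q) (q : Q) : GBA Al Q :=
  { Au with init := {q} }

/-- The language of the automaton started in state `q`. -/
def LangFrom (Au : GBA Al Q) (q : Q) : Set (ℕ → Al) :=
  (Au.from1 q).Lang

/-- Separated automaton: distinct states recognize disjoint languages. -/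
def Separated (Au : GBA Al Q) : Prop :=
  ∀ q q' : Q, q ≠ q' → Au.LangFrom q ∩ Au.LangFrom q' = ∅

/-- Reverse determinism: every state has exactly one `a`-predecessor for each letter `a`. -/
def RevDet (Au : GBA Al Q) : Prop :=
  ∀ (q' : Q) (a : Al), ∃! q : Q, q' ∈ Au.T q a

/-- Fully partitioned automaton: separated, every word is accepted from some
state, and reverse deterministic. -/
def FullyPartitioned (Au : GBA Al Q) : Prop :=
  Au.Separated ∧ (∀ w : ℕ → Al, ∃ q : Q, w ∈ Au.LangFrom q) ∧ Au.RevDet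

/-- A state is reenterable if it has some predecessor. -/
def Reenterable (Au : GBA Al Q) (q : Q) : Prop :=
  ∃ (p : Q) (a : Al), q ∈ Au.T p a

/-- The restriction of an automaton to its reenterable states, all of them initial. -/
def restrict (Au : GBA Al Q) : GBA Al {q : Q // Au.Reenterable q} where
  T q a := {q' | q'.1 ∈ Au.T q.1 a}
  init := Set.univ
  acc := (fun F => {t : {q : Q // Au.Reenterable q} × Al × {q : Q // Au.Reenterable q} |
            (t.1.1, t.2.1, t.2.2.1) ∈ F}) '' Au.acc

/-- Almost fully partitioned: the restriction to reenterable states is fully partitioned. -/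
def AlmostFullyPartitioned (Au : GBA Al Q) : Prop :=
  Au.restrict.FullyPartitioned

end GBA

/-- The transition function of the automaton `A_φ`; the state `none` is the
initial state `φ`, the state `some V` is the subset state `V ⊆ el φ`. -/
def autT {AP : Type} (φ : LTL AP) :
    Option (Set (LTL AP)) → Set AP → Set (Option (Set (LTL AP)))
  | none, a => {q' | ∃ V : Set (LTL AP), q' = some V ∧ V ⊆ φ.el ∧ LTL.sd V a φ}
  | some V, a => {q' | ∃ U : Set (LTL AP), q' = some U ∧ U ⊆ φ.el ∧
      ∀ ψ : LTL AP, LTL.next ψ ∈ φ.el → (LTL.next ψ ∈ V ↔ LTL.sd U a ψ)}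

/-- The generalized Büchi automaton `A_φ` of an LTL formula `φ`. -/
def aut {AP : Type} (φ : LTL AP) : GBA (Set AP) (Option (Set (LTL AP))) where
  T := autT φ
  init := {none}
  acc := {F | ∃ φ₁ φ₂ : LTL AP, LTL.Subf (LTL.untl φ₁ φ₂) φ ∧
    F = {t : Option (Set (LTL AP)) × Set AP × Option (Set (LTL AP)) |
          t.2.2 ∈ autT φ t.1 t.2.1 ∧
          ∃ V : Set (LTL AP), t.2.2 = some V ∧
            (LTL.sd V t.2.1 φ₂ ∨ ¬ LTL.sd V t.2.1 (LTL.untl φ₁ φ₂))}}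

/-- The automaton `A_φ^U` for `U ⊆ el φ`. -/
def autFrom {AP : Type} (φ : LTL AP) (U : Set (LTL AP)) :
    GBA (Set AP) (Option (Set (LTL AP))) :=
  (aut φ).from1 (some U)

/-- A (finite, labelled) Markov chain with state space `S` and labels in `Al`. -/
structure MC (S : Type) (Al : Type) where
  L : S → Al
  init : S
  P : S → S → ℝ≥0∞

namespace MC

variable {S Al : Type}

/-- The edge relation of the underlying graph of the Markov chain. -/
def E (M : MC S Al) : S → S → Prop := fun s s' => 0 < M.P s s'

/-- The labelled word generated by a path of the Markov chain. -/
def word (M : MC S Al) (π : ℕ → S) : ℕ → Al := fun i => M.L (π i)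

end MC

/-- The edge relation of the product graph `A × M`. -/
def prodE {S Al Q : Type} (Au : GBA Al Q) (M : MC S Al) : Q × S → Q × S → Prop :=
  fun v v' => M.E v.2 v'.2 ∧ v'.1 ∈ Au.T v.1 (M.L v.2)

/-- All vertices of `C` are mutually reachable. -/
def MutReach {V : Type} (E : V → V → Prop) (C : Set V) : Prop :=
  ∀ u ∈ C, ∀ v ∈ C, Relation.ReflTransGen E u v

/-- `C` is a (non-extensible, i.e. maximal) strongly connected component. -/
def IsSCC {V : Type} (E : V → V → Prop) (C : Set V) : Prop :=
  C.Nonempty ∧ MutReach E C ∧ ∀ C' : Set V, C ⊆ C' → MutReach E C' → C' = C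

/-- `SCCle E C C'` : some vertex of `C'` is reachable from some vertex of `C`. -/
def SCCle {V : Type} (E : V → V → Prop) (C C' : Set V) : Prop :=
  ∃ u ∈ C, ∃ v ∈ C', Relation.ReflTransGen E u v

/-- A bottom SCC: an SCC maximal with respect to reachability. -/
def IsBSCC {V : Type} (E : V → V → Prop) (C : Set V) : Prop :=
  IsSCC E C ∧ ∀ C' : Set V, IsSCC E C' → SCCle E C C' → C' = C

/-- A finite path of the graph `E` lying in the set `C`. -/
def FinPathIn {V : Type} (E : V → V → Prop) (C : Set V) (l : List V) : Prop :=
  l.Chain' E ∧ ∀ v ∈ l, v ∈ C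

/-- An infinite path of the graph `E` lying in the set `C`. -/
def InfPathIn {V : Type} (E : V → V → Prop) (C : Set V) (π : ℕ → V) : Prop :=
  (∀ i, E (π i) (π (i + 1))) ∧ ∀ i, π i ∈ C

/-- The infinite path `π` visits the finite path `l` infinitely often, i.e. `l`
occurs as a contiguous fragment starting at infinitely many positions of `π`. -/
def VisitsInfOften {V : Type} (π : ℕ → V) (l : List V) : Prop :=
  {n : ℕ | ∀ i : Fin l.length, π (n + i.1) = l.get i}.Infinite

/-- The projection `H(C)` of a set of product vertices to the Markov chain. -/
def Hproj {Q S : Type} (C : Set (Q × S)) : Set S := Prod.snd '' C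

/-- A complete SCC of the product graph: every finite path of `H(C)` is the
projection of some finite path in `C`. -/
def CompleteSCC {S Al Q : Type} (Au : GBA Al Q) (M : MC S Al) (C : Set (Q × S)) : Prop :=
  ∀ l : List S, FinPathIn M.E (Hproj C) l →
    ∃ σ : List (Q × S), FinPathIn (prodE Au M) C σ ∧ σ.map Prod.snd = l

/-- An accepting SCC of the product graph. -/
def AcceptingSCC {S Al Q : Type} (Au : GBA Al Q) (M : MC S Al) (C : Set (Q × S)) : Prop :=
  ∀ F ∈ Au.acc, ∃ v ∈ C, ∃ v' ∈ C, prodE Au M v v' ∧ (v.1, M.L v.2, v'.1) ∈ F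

/-- A locally positive SCC: accepting, complete, and `H(C)` is a bottom SCC of
the underlying graph of `M`. -/
def LocallyPositive {S Al Q : Type} (Au : GBA Al Q) (M : MC S Al) (C : Set (Q × S)) : Prop :=
  AcceptingSCC Au M C ∧ CompleteSCC Au M C ∧ IsBSCC M.E (Hproj C)

/-- The σ-algebra on `ℕ → S` generated by the cylinder sets. -/
def CylSigma (S : Type) : MeasurableSpace (ℕ → S) :=
  MeasurableSpace.generateFrom
    {A : Set (ℕ → S) | ∃ l : List S, A = {π | ∀ i : Fin l.length, π i.1 = l.get i}}

/-- `μ` is the path measure of the Markov chain with transition matrix `P` and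
initial state `s`: the measure of each cylinder is the product of the transition
probabilities along it. -/
def IsPathMeasure {S : Type} [DecidableEq S] (P : S → S → ℝ≥0∞) (s : S)
    (μ : @MeasureTheory.Measure (ℕ → S) (CylSigma S)) : Prop :=
  ∀ (k : ℕ) (f : ℕ → S),
    μ {π | ∀ i ≤ k, π i = f i} =
      (if f 0 = s then 1 else 0) * ∏ i ∈ Finset.range k, P (f i) (f (i + 1))

/-- An SCC contains every vertex lying between two of its vertices. -/
theorem IsSCC.mem_of_between {V : Type} {E : V → V → Prop} {C : Set V} (hC : IsSCC E C)
    {u b v : V} (hu : u ∈ C) (hv : v ∈ C) (hub : Relation.ReflTransGen E u b)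
    (hbv : Relation.ReflTransGen E b v) : b ∈ C := by
  have h : insert b C = C := by
    refine hC.2.2 _ (Set.subset_insert b C) ?_
    rintro x (rfl | hx) y (rfl | hy)
    · exact .refl
    · exact hbv.trans (hC.2.1 v hv y hy)
    · exact (hC.2.1 x hx u hu).trans hub
    · exact hC.2.1 x hx y hy
  exact h ▸ Set.mem_insert b C

/-- A nonempty path in an SCC can be continued within the SCC to any of its vertices. -/
theorem IsSCC.exists_path_to {V : Type} {E : V → V → Prop} {C : Set V} (hC : IsSCC E C)
    {ρ : List V} (hρ : FinPathIn E C ρ) (hne : ρ ≠ []) {v : V} (hv : v ∈ C) :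
    ∃ p : List V, FinPathIn E C (p ++ [v]) ∧ ρ <:+: p ++ [v] := by
  have hu := hρ.2 _ (List.getLast_mem hne)
  have key : Relation.ReflTransGen E (ρ.getLast hne) v := hC.2.1 _ hu v hv
  induction key with
  | refl =>
    refine ⟨ρ.dropLast, ?_⟩
    rw [List.dropLast_append_getLast]
    exact ⟨hρ, List.infix_refl ρ⟩
  | @tail b c hub hbc ih =>
    obtain ⟨p, hp, hin⟩ := ih (hC.mem_of_between hu hv hub (.single hbc))
    refine ⟨p ++ [b], ⟨?_, ?_⟩, hin.trans (List.prefix_append _ _).isInfix⟩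
    · have h1 := hp.1
      simp only [List.append_assoc, List.singleton_append]
      exact List.isChain_split.2 ⟨h1, by simpa using hbc⟩
    · intro x hx
      rcases List.mem_append.1 hx with hx | hx
      · exact hp.2 x hx
      · rw [List.mem_singleton.1 hx]; exact hv

/-- Under reverse determinism, a product path is determined by its projection and its
last vertex. -/
theorem GBA.RevDet.path_unique {S Al Q : Type} {Au : GBA Al Q} (hrev : Au.RevDet)
    (M : MC S Al) {σ τ : List (Q × S)} (hσ : σ.IsChain (prodE Au M))
    (hτ : τ.IsChain (prodE Au M)) (hmap : σ.map Prod.snd = τ.map Prod.snd)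
    (hlast : σ.getLast? = τ.getLast?) : σ = τ := by
  induction σ generalizing τ with
  | nil => exact (List.map_eq_nil_iff.1 hmap.symm).symm
  | cons a σ ih =>
    rcases τ with _ | ⟨b, τ⟩
    · simp at hmap
    · simp only [List.map_cons, List.cons.injEq] at hmap
      rcases σ with _ | ⟨c, σ⟩
      · have : τ = [] := List.map_eq_nil_iff.1 hmap.2.symm
        subst this
        simpa using hlast
      · rcases τ with _ | ⟨d, τ⟩
        · simp at hmap
        · rw [List.isChain_cons_cons] at hσ hτ
          have ht := ih hσ.2 hτ.2 hmap.2 (by simpa using hlast)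
          have hcd : c = d := (List.cons.inj ht).1
          have hb := hτ.1.2
          rw [← hcd, ← hmap.1] at hb
          rw [ht, Prod.ext ((hrev c.1 (M.L a.2)).unique hσ.1.2 hb) hmap.1]

theorem FinPathIn.map_snd {S Al Q : Type} {Au : GBA Al Q} {M : MC S Al} {C : Set (Q × S)}
    {σ : List (Q × S)} (hσ : FinPathIn (prodE Au M) C σ) :
    FinPathIn M.E (Hproj C) (σ.map Prod.snd) := by
  refine ⟨(List.isChain_map _).2 (List.IsChain.imp (fun _ _ h => h.1) hσ.1), ?_⟩
  intro s hs
  obtain ⟨v, hv, rfl⟩ := List.mem_map.1 hs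
  exact ⟨v, hσ.2 v hv, rfl⟩

/-- Some path in `H(C)` ending in `v.2` forces `ρ` in all of its lifts to `C` whose last
vertex has its automaton state in a given finite set. -/
theorem IsSCC.exists_forcing_path {S Al Q : Type} {Au : GBA Al Q} {M : MC S Al}
    (hrev : Au.RevDet) {C : Set (Q × S)} (hC : IsSCC (prodE Au M) C)
    {ρ : List (Q × S)} (hρ : FinPathIn (prodE Au M) C ρ) (hne : ρ ≠ [])
    {s : S} (hs : s ∈ Hproj C) (F : Finset Q) :
    ∃ l : List S, FinPathIn M.E (Hproj C) (l ++ [s]) ∧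
      ∀ σ : List (Q × S), FinPathIn (prodE Au M) C σ → σ.map Prod.snd = l ++ [s] →
        ∀ q ∈ F, σ.getLast? = some (q, s) → ρ <:+: σ := by
  classical
  induction F using Finset.induction_on with
  | empty => exact ⟨[], ⟨List.isChain_singleton s, by simpa using hs⟩, by simp⟩
  | insert q F _ ih =>
    obtain ⟨l, hl, hforce⟩ := ih
    by_cases hlift : ∃ σ : List (Q × S), FinPathIn (prodE Au M) C σ ∧
        σ.map Prod.snd = l ++ [s] ∧ σ.getLast? = some (q, s)
    · obtain ⟨σ, hσ, hmap, hlast⟩ := hlift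
      rcases σ with _ | ⟨v, σ⟩
      · simp at hlast
      obtain ⟨p, hp, hin⟩ := hC.exists_path_to hρ hne (hσ.2 v (by simp))
      have hpath : FinPathIn (prodE Au M) C (p ++ v :: σ) := by
        refine ⟨List.isChain_split.2 ⟨hp.1, hσ.1⟩, fun x hx => ?_⟩
        rcases List.mem_append.1 hx with hx | hx
        · exact hp.2 x (by simp [hx])
        · exact hσ.2 x hx
      have hpmap : (p ++ v :: σ).map Prod.snd = p.map Prod.snd ++ l ++ [s] := by
        rw [List.map_append, hmap, List.append_assoc]
      refine ⟨p.map Prod.snd ++ l, hpmap ▸ hpath.map_snd, fun τ hτ hτmap r hr hτlast => ?_⟩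
      rcases Finset.mem_insert.1 hr with rfl | hr
      · have : τ = p ++ v :: σ := by
          refine hrev.path_unique M hτ.1 hpath.1 (hτmap.trans hpmap.symm) ?_
          rw [hτlast, List.getLast?_append, hlast]
          rfl
        rw [this]
        exact hin.trans ⟨[], σ, by simp⟩
      · rw [List.append_assoc] at hτmap
        obtain ⟨τ₁, τ₂, rfl, -, h₂⟩ := List.map_eq_append_iff.1 hτmap
        have hτ₂ : τ₂ ≠ [] := by rintro rfl; simp at h₂
        refine (hforce τ₂ ⟨(List.isChain_append.1 hτ.1).2.1,
          fun x hx => hτ.2 x (List.mem_append_right _ hx)⟩ h₂ r hr ?_).trans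
          (List.suffix_append τ₁ τ₂).isInfix
        rwa [List.getLast?_append_of_ne_nil _ hτ₂] at hτlast
    · refine ⟨l, hl, fun τ hτ hτmap r hr hτlast => ?_⟩
      rcases Finset.mem_insert.1 hr with rfl | hr
      · exact absurd ⟨τ, hτ, hτmap, hτlast⟩ hlift
      · exact hforce τ hτ hτmap r hr hτlast

/-- Let `A` be a reverse deterministic GBA, `M` a finite Markov
chain, `G = A × M` their product graph, and `C` a complete SCC of `G` with
`K = H(C)`. Then for every finite path `ρ` lying in `C` there exists a finite
path `σ_K` in `K` such that every finite path `σ` in `C` with `proj σ = σ_K`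
contains `ρ` as a contiguous fragment. -/
theorem complete_scc_forcing_path {S Al Q : Type}
    [Fintype S] [Fintype Al] [Fintype Q]
    (Au : GBA Al Q) (M : MC S Al)
    (hM : ∀ s : S, ∑ t : S, M.P s t = 1)
    (hrev : Au.RevDet)
    (C : Set (Q × S)) (hC : IsSCC (prodE Au M) C)
    (hcomp : CompleteSCC Au M C)
    (ρ : List (Q × S)) (hρ : FinPathIn (prodE Au M) C ρ) :
    ∃ σK : List S, FinPathIn M.E (Hproj C) σK ∧
      ∀ σ : List (Q × S), FinPathIn (prodE Au M) C σ →
        σ.map Prod.snd = σK → ρ <:+: σ := by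
  by_cases hne : ρ = []
  · exact ⟨[], ⟨List.isChain_nil, by simp⟩, fun σ _ _ => hne ▸ List.nil_infix⟩
  obtain ⟨v, hv⟩ := hC.1
  obtain ⟨l, hl, hforce⟩ := hC.exists_forcing_path hrev hρ hne ⟨v, hv, rfl⟩ Finset.univ
  refine ⟨l ++ [v.2], hl, fun σ hσ hmap => ?_⟩
  have hlast : (σ.getLast?).map Prod.snd = some v.2 := by
    rw [← List.getLast?_map, hmap]
    simp
  obtain ⟨⟨q, s⟩, hq, rfl⟩ := Option.map_eq_some_iff.1 hlast
  exact hforce σ hσ hmap q (Finset.mem_univ q) hq
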